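/- Let η be a (1,0)-form on a complex manifold with |η|² = λ² a constant and suppose ∂̄η = (2/(n−1))·(√(−1)·λ²·ω̂ + η ∧ conj(η)) where ω̂ is a positive (1,1)-form. Let ω = √(−1)·Σ_i λ_i φ_i ∧ conj(φ_i) be a positive (1,1)-form diagonalized in a unitary coframe φ for ω̂, with λ_i > 0. Then √(−1)·(∂̄η + (2(n−2)/(n−1))·η ∧ conj(η)) ∧ ω̂^{n−2} ∧ ω = −2·(Σ_r λ_r |η_r|²)·ω̂^n / (n(n−1)), where η = Σ_r η_r φ_r. In particular, if the integral of the left-hand side over a compact manifold vanishes, then η = 0. -/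

import Mathlib

theorem prod_mul_eq_zero_of_mem {ι R : Type*} [DecidableEq ι] [CommRing R] (a : ι → R)
    (ha : ∀ i, a i * a i = 0) {s : Finset ι} {i : ι} (hi : i ∈ s) :
    (∏ j ∈ s, a j) * a i = 0 := by
  rw [← Finset.mul_prod_erase s a hi]
  linear_combination (∏ j ∈ s.erase i, a j) * ha i

theorem prod_mul_sum_eq_zero {ι R : Type*} [DecidableEq ι] [CommRing R] (a : ι → R)
    (ha : ∀ i, a i * a i = 0) (s : Finset ι) :
    (∏ i ∈ s, a i) * ∑ i ∈ s, a i = 0 := by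
  rw [Finset.mul_sum]
  exact Finset.sum_eq_zero fun i hi => prod_mul_eq_zero_of_mem a ha hi

open scoped Nat in
theorem sum_pow_card_of_mul_self_eq_zero {ι R : Type*} [DecidableEq ι] [CommRing R] (a : ι → R)
    (ha : ∀ i, a i * a i = 0) (s : Finset ι) :
    (∑ i ∈ s, a i) ^ s.card = (s.card ! : R) * ∏ i ∈ s, a i := by
  have add_pow_succ (x y : R) (hx : x * x = 0) (k : ℕ) :
      (x + y) ^ (k + 1) = y ^ (k + 1) + (k + 1) * y ^ k * x := by
    induction k with
    | zero => simp [add_comm]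
    | succ k ih =>
      rw [pow_succ, ih]
      push_cast
      linear_combination ((k : R) + 1) * y ^ k * hx
  induction s using Finset.induction_on with
  | empty => simp
  | insert i s hi ih =>
    rw [Finset.sum_insert hi, Finset.prod_insert hi, Finset.card_insert_of_notMem hi,
      add_pow_succ _ _ (ha i), pow_succ, ih, Nat.factorial_succ]
    push_cast
    linear_combination (s.card ! : R) * prod_mul_sum_eq_zero a ha s

theorem sum_pow_eq_zero_of_card_lt {ι R : Type*} [DecidableEq ι] [CommRing R] (a : ι → R)
    (ha : ∀ i, a i * a i = 0) (s : Finset ι) {k : ℕ} (hk : s.card < k) :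
    (∑ i ∈ s, a i) ^ k = 0 := by
  refine pow_eq_zero_of_le hk ?_
  rw [pow_succ, sum_pow_card_of_mul_self_eq_zero a ha, mul_assoc,
    prod_mul_sum_eq_zero a ha, mul_zero]

theorem mul_sum_pow_eq_mul_sum_compl_pow {ι R : Type*} [Fintype ι] [DecidableEq ι] [CommRing R]
    (a : ι → R) (x : R) (t : Finset ι) (hx : ∀ i ∈ t, x * a i = 0) (k : ℕ) :
    x * (∑ i, a i) ^ k = x * (∑ i ∈ tᶜ, a i) ^ k := by
  have h : x * ∑ i ∈ t, a i = 0 := by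
    rw [Finset.mul_sum]
    exact Finset.sum_eq_zero hx
  rw [← Finset.sum_add_sum_compl t a]
  induction k with
  | zero => simp
  | succ k ih =>
    rw [pow_succ, pow_succ, ← mul_assoc, ih]
    linear_combination (∑ i ∈ tᶜ, a i) ^ k * h

open scoped Nat in
theorem prod_mul_sum_pow {ι R : Type*} [Fintype ι] [DecidableEq ι] [CommRing R]
    (a : ι → R) (ha : ∀ i, a i * a i = 0) (t : Finset ι) {k : ℕ}
    (hk : t.card + k = Fintype.card ι) :
    (∏ i ∈ t, a i) * (∑ i, a i) ^ k = (k ! : R) * ∏ i, a i := by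
  have hc : k = tᶜ.card := by rw [Finset.card_compl]; omega
  rw [mul_sum_pow_eq_mul_sum_compl_pow a _ t, hc, sum_pow_card_of_mul_self_eq_zero a ha,
    ← Finset.prod_mul_prod_compl t a]
  · ring
  · exact fun i hi => prod_mul_eq_zero_of_mem a ha hi

/-- The commutative-algebra content: `x r s` plays the role of the central element
`φ r ∧ conj (φ s)`. -/
theorem vaisman_pointwise_identity {R : Type*} [CommRing R] [Algebra ℂ R] {m : ℕ}
    (x : Fin (m + 2) → Fin (m + 2) → R)
    (hl : ∀ r s t, x r s * x r t = 0) (hr : ∀ r s t, x s r * x t r = 0)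
    (l : ℂ) (lamE η : Fin (m + 2) → ℂ) (hnorm : ∑ r, η r * star (η r) = l) :
    Complex.I • (((2 / ((m : ℂ) + 1)) • ((Complex.I * l) • (Complex.I • ∑ r, x r r)
          + ∑ r, ∑ s, (η r * star (η s)) • x r s)
        + (2 * (m : ℂ) / ((m : ℂ) + 1)) • ∑ r, ∑ s, (η r * star (η s)) • x r s)
        * (Complex.I • ∑ r, x r r) ^ m * (Complex.I • ∑ r, lamE r • x r r))
      = (-(2 / (((m : ℂ) + 2) * ((m : ℂ) + 1))) * ∑ r, lamE r * (η r * star (η r))) •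
        (Complex.I • ∑ r, x r r) ^ (m + 2) := by
  set a : Fin (m + 2) → R := fun r => Complex.I • x r r with ha_def
  have ha : ∀ i, a i * a i = 0 := fun i => by simp [ha_def, hl]
  have hS : Complex.I • ∑ r, x r r = ∑ r, a r := Finset.smul_sum
  have hω : Complex.I • ∑ r, lamE r • x r r = ∑ r, lamE r • a r := by
    simp only [Finset.smul_sum, ha_def, smul_comm Complex.I]
  rw [hS, hω]
  set S := ∑ r, a r with hS_def
  set P := ∏ r, a r with hP_def
  set N := ∑ r, ∑ s, (η r * star (η s)) • x r s with hN_def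
  set ω := ∑ r, lamE r • a r with hω_def
  have hcard : Fintype.card (Fin (m + 2)) = m + 2 := Fintype.card_fin _
  have htop : S ^ (m + 2) = ((m + 2).factorial : ℂ) • P := by
    have := prod_mul_sum_pow a ha ∅ (k := m + 2) (by simp)
    simpa [Algebra.smul_def] using this
  have hone (r) : a r * S ^ (m + 1) = ((m + 1).factorial : ℂ) • P := by
    have := prod_mul_sum_pow a ha {r} (k := m + 1) (by simp; omega)
    simpa [Algebra.smul_def] using this
  have htwo (r s) : a r * S ^ m * a s =
      (if s = r then 0 else (m.factorial : ℂ)) • P := by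
    split_ifs with h
    · subst h
      linear_combination S ^ m * ha s - zero_smul ℂ P
    · have := prod_mul_sum_pow a ha {r, s} (k := m) (by
        rw [Finset.card_pair (Ne.symm h), hcard]; omega)
      rw [Finset.prod_pair (Ne.symm h)] at this
      rw [Algebra.smul_def, map_natCast, ← this]
      ring
  have hoff (r s t) (hrs : r ≠ s) : x r s * S ^ m * a t = 0 := by
    have hxr : x r s * a r = 0 := by simp [ha_def, hl]
    have hxs : x r s * a s = 0 := by simp [ha_def, hr]
    by_cases htr : t = r
    · subst htr; linear_combination S ^ m * hxr
    by_cases hts : t = s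
    · subst hts; linear_combination S ^ m * hxs
    have h := mul_sum_pow_eq_mul_sum_compl_pow a (x r s * a t) {r, s, t} (by
      intro i hi
      simp only [Finset.mem_insert, Finset.mem_singleton] at hi
      rcases hi with rfl | rfl | rfl
      · linear_combination a t * hxr
      · linear_combination a t * hxs
      · linear_combination x r s * ha i) m
    have hthree : ({r, s, t} : Finset (Fin (m + 2))).card = 3 :=
      Finset.card_eq_three.2 ⟨r, s, t, hrs, Ne.symm htr, Ne.symm hts, rfl⟩
    have hle := Finset.card_le_univ ({r, s, t} : Finset (Fin (m + 2)))
    have hlt : ({r, s, t}ᶜ : Finset (Fin (m + 2))).card < m := by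
      rw [Finset.card_compl]
      omega
    rw [sum_pow_eq_zero_of_card_lt a ha _ hlt, mul_zero] at h
    linear_combination h
  have hSω : S * S ^ m * ω = (((m + 1).factorial : ℂ) * ∑ r, lamE r) • P := by
    rw [← pow_succ', hω_def, Finset.mul_sum, Finset.mul_sum, Finset.sum_smul]
    refine Finset.sum_congr rfl fun r _ => ?_
    rw [mul_smul_comm, mul_comm, hone, smul_smul, mul_comm]
  have hdiag (r) : x r r = (-Complex.I) • a r := by
    simp [ha_def, smul_smul]
  have hNω : N * S ^ m * ω = (-Complex.I * (m.factorial : ℂ) *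
      (l * ∑ r, lamE r - ∑ r, lamE r * (η r * star (η r)))) • P := by
    have hxω (r s) : x r s * S ^ m * ω =
        (if s = r then -Complex.I * (m.factorial : ℂ) * (∑ t, lamE t - lamE r) else 0) • P := by
      rw [hω_def, Finset.mul_sum]
      split_ifs with h
      · subst h
        have hsum : (∑ t, lamE t) - lamE s = ∑ t, if t = s then 0 else lamE t := by
          rw [sub_eq_iff_eq_add, ← Finset.sum_erase_add _ _ (Finset.mem_univ s)]
          congr 1
          rw [← Finset.sum_erase_add (a := s) _ (fun t => if t = s then 0 else lamE t)
            (Finset.mem_univ s)]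
          simp only [if_true, add_zero]
          exact Finset.sum_congr rfl fun t ht => by simp [Finset.ne_of_mem_erase ht]
        rw [hsum, Finset.mul_sum, Finset.sum_smul]
        refine Finset.sum_congr rfl fun t _ => ?_
        rw [hdiag, smul_mul_assoc, smul_mul_assoc, mul_smul_comm, htwo, smul_smul, smul_smul]
        congr 1
        split_ifs <;> ring
      · rw [zero_smul]
        refine Finset.sum_eq_zero fun t _ => ?_
        rw [mul_smul_comm, hoff r s t (Ne.symm h), smul_zero]
    simp only [hN_def, Finset.sum_mul, smul_mul_assoc, hxω, smul_smul, ← Finset.sum_smul]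
    congr 1
    simp only [mul_ite, mul_zero, Finset.sum_ite_eq', Finset.mem_univ, if_true]
    rw [← hnorm, Finset.sum_mul, ← Finset.sum_sub_distrib, Finset.mul_sum]
    exact Finset.sum_congr rfl fun r _ => by ring
  have hsplit : Complex.I • (((2 / ((m : ℂ) + 1)) • ((Complex.I * l) • S + N)
        + (2 * (m : ℂ) / ((m : ℂ) + 1)) • N) * S ^ m * ω)
      = (Complex.I * (2 / ((m : ℂ) + 1)) * (Complex.I * l)) • (S * S ^ m * ω)
        + (Complex.I * (2 / ((m : ℂ) + 1) + 2 * (m : ℂ) / ((m : ℂ) + 1))) •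
          (N * S ^ m * ω) := by
    simp only [add_mul, smul_mul_assoc]
    module
  rw [hsplit, hSω, hNω, htop, smul_smul, smul_smul, smul_smul, ← add_smul]
  congr 1
  have h1 : (m : ℂ) + 1 ≠ 0 := by exact_mod_cast Nat.succ_ne_zero m
  have h2 : (m : ℂ) + 2 ≠ 0 := by exact_mod_cast Nat.succ_ne_zero (m + 1)
  generalize ∑ r, lamE r * (η r * star (η r)) = T
  simp only [Nat.factorial_succ]
  push_cast
  field_simp
  linear_combination ((m : ℂ) + 1) * (m + 2) * m.factorial * T * Complex.I_sq

/-- Products of two vectors are central in the exterior algebra. -/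
theorem ExteriorAlgebra.ι_mul_ι_mem_center {K V : Type*} [CommRing K] [AddCommGroup V] [Module K V]
    (v w : V) :
    ExteriorAlgebra.ι K v * ExteriorAlgebra.ι K w ∈ Subalgebra.center K (ExteriorAlgebra K V) := by
  have swap (u v : V) : ExteriorAlgebra.ι K u * ExteriorAlgebra.ι K v =
      -(ExteriorAlgebra.ι K v * ExteriorAlgebra.ι K u) :=
    eq_neg_of_add_eq_zero_left (ExteriorAlgebra.ι_add_mul_swap u v)
  rw [Subalgebra.mem_center_iff]
  intro b
  induction b using ExteriorAlgebra.induction with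
  | algebraMap r => exact Algebra.commutes r _
  | ι u => rw [← mul_assoc, swap u v, neg_mul, mul_assoc, swap u w, mul_neg, neg_neg, mul_assoc]
  | mul a b ha hb => rw [mul_assoc, hb, ← mul_assoc, ha, mul_assoc]
  | add a b ha hb => rw [add_mul, mul_add, ha, hb]

/-- The pointwise computation in the non-existence proof of Vaisman metrics on
compact non-Kähler SKL manifolds. Forms are modelled in the exterior algebra on
`(Fin n → ℂ) × (Fin n → ℂ)`, with `φ r` the `(1,0)`-coframe and `ψ r` its conjugate. -/
theorem stmt14 (n : ℕ) (hn : 3 ≤ n)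
    (lam : ℝ) (hlam : 0 < lam)
    (lamE : Fin n → ℝ) (hlamE : ∀ i, 0 < lamE i)
    (ηc : Fin n → ℂ) (hnorm : ∑ r, Complex.normSq (ηc r) = lam ^ 2) :
    let V := (Fin n → ℂ) × (Fin n → ℂ)
    let φ : Fin n → ExteriorAlgebra ℂ V := fun i => ExteriorAlgebra.ι ℂ (Pi.single i 1, 0)
    let ψ : Fin n → ExteriorAlgebra ℂ V := fun i => ExteriorAlgebra.ι ℂ (0, Pi.single i 1)
    let ωh : ExteriorAlgebra ℂ V := Complex.I • ∑ r, φ r * ψ r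
    let ω : ExteriorAlgebra ℂ V := Complex.I • ∑ r, (lamE r : ℂ) • (φ r * ψ r)
    let η : ExteriorAlgebra ℂ V := ∑ r, ηc r • φ r
    let ηb : ExteriorAlgebra ℂ V := ∑ r, star (ηc r) • ψ r
    let dbη : ExteriorAlgebra ℂ V :=
      (2 / ((n : ℂ) - 1)) • ((Complex.I * (lam : ℂ) ^ 2) • ωh + η * ηb)
    (Complex.I • ((dbη + ((2 * ((n : ℂ) - 2) / ((n : ℂ) - 1)) • (η * ηb)))
        * ωh ^ (n - 2) * ω)
      = (-(2 / ((n : ℂ) * ((n : ℂ) - 1))) *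
          (∑ r, (lamE r : ℂ) * (Complex.normSq (ηc r) : ℂ))) • ωh ^ n)
    ∧ ((∑ r, lamE r * Complex.normSq (ηc r)) = 0 → ∀ r, ηc r = 0) := by
  intro V φ ψ ωh ω η ηb dbη
  refine ⟨?_, fun h r => ?_⟩
  · obtain ⟨m, rfl⟩ : ∃ m, n = m + 2 := ⟨n - 2, by omega⟩
    let x : Fin (m + 2) → Fin (m + 2) → Subalgebra.center ℂ (ExteriorAlgebra ℂ V) :=
      fun r s => ⟨φ r * ψ s, ExteriorAlgebra.ι_mul_ι_mem_center _ _⟩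
    have sq (v : V) : ExteriorAlgebra.ι ℂ v * ExteriorAlgebra.ι ℂ v = 0 :=
      ExteriorAlgebra.ι_sq_zero v
    have hl (r s t) : x r s * x r t = 0 := by
      apply Subtype.ext
      change φ r * ψ s * (φ r * ψ t) = 0
      rw [← mul_assoc, ← Subalgebra.mem_center_iff.1 (x r s).2 (φ r), ← mul_assoc, sq, zero_mul,
        zero_mul]
    have hr (r s t) : x s r * x t r = 0 := by
      apply Subtype.ext
      change φ s * ψ r * (φ t * ψ r) = 0
      rw [mul_assoc, Subalgebra.mem_center_iff.1 (x t r).2 (ψ r), mul_assoc, sq, mul_zero,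
        mul_zero]
    have key := congrArg (Subalgebra.center ℂ (ExteriorAlgebra ℂ V)).val
      (vaisman_pointwise_identity x hl hr ((lam : ℂ) ^ 2) (fun r => (lamE r : ℂ)) ηc (by
        rw [← Complex.ofReal_pow, ← hnorm, Complex.ofReal_sum]
        exact Finset.sum_congr rfl fun r _ => Complex.mul_conj _))
    have hx (r s) : (Subalgebra.center ℂ (ExteriorAlgebra ℂ V)).val (x r s) = φ r * ψ s := rfl
    have hη : η * ηb = ∑ r, ∑ s, (ηc r * star (ηc s)) • (φ r * ψ s) := by
      simp only [η, ηb, Finset.sum_mul_sum, smul_mul_smul_comm]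
    have hmul (r) : ηc r * star (ηc r) = (Complex.normSq (ηc r) : ℂ) := Complex.mul_conj _
    simp only [map_smul, map_mul, map_add, map_pow, map_sum, hx] at key
    have hn1 : ((m + 2 : ℕ) : ℂ) - 1 = m + 1 := by push_cast; ring
    have hn2 : ((m + 2 : ℕ) : ℂ) - 2 = m := by push_cast; ring
    have hn0 : ((m + 2 : ℕ) : ℂ) = m + 2 := by push_cast; ring
    simp only [dbη, hη, hn1, hn2, Nat.add_sub_cancel, ← hmul]
    rw [hn0]
    exact key
  · have hz := (Finset.sum_eq_zero_iff_of_nonneg fun i _ =>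
      mul_nonneg (hlamE i).le (Complex.normSq_nonneg (ηc i))).1 h r (Finset.mem_univ r)
    exact Complex.normSq_eq_zero.1 ((mul_eq_zero.1 hz).resolve_left (hlamE r).ne')
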